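/- arXiv:1903.03541 — 2 statements merged into one kernel-verified Lean document; each statement's English description precedes it below -/
import Mathlib

section
/- Let C ∈ K₀ be a 0-primitive extension of B ⊊ C (primitive with δ(C) = δ(B)). Then there exists c ∈ C ∖ B incident with a line of C based in B if and only if |C ∖ B| = 1. In that case, writing C ∖ B = {c} and ℓ for the line of C through c based in B: for every 2-element subset B' ⊆ ℓ ∩ B, the pair (B', {c}) is a good pair; and for b ∈ B, the points b and c lie on a common nontrivial line of C if and only if b ∈ ℓ. -/
open scoped Classical

/-- A (one-sorted) linear space: a ternary collinearity relation that holds only of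
pairwise distinct triples, is invariant under all permutations of its arguments, and
satisfies that two points determine at most one line. -/
structure IsLinearSpace {M : Type*} (R : M → M → M → Prop) : Prop where
  ne12 : ∀ {a b c : M}, R a b c → a ≠ b
  ne23 : ∀ {a b c : M}, R a b c → b ≠ c
  ne13 : ∀ {a b c : M}, R a b c → a ≠ c
  swap12 : ∀ {a b c : M}, R a b c → R b a c
  swap23 : ∀ {a b c : M}, R a b c → R a c b
  line : ∀ {x y z w : M}, R x y z → R x y w → z ≠ w → R x w z

/-- `X` is an `R`-clique: every three pairwise distinct elements of `X` satisfy `R`. -/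
def FinClique {M : Type*} (R : M → M → M → Prop) (X : Finset M) : Prop :=
  ∀ a ∈ X, ∀ b ∈ X, ∀ c ∈ X, a ≠ b → b ≠ c → a ≠ c → R a b c

/-- `ℓ` is a nontrivial line of the induced structure on `A`:
a maximal `R`-clique of `A` of size at least 3. -/
def IsLineOf {M : Type*} (R : M → M → M → Prop) (A ℓ : Finset M) : Prop :=
  ℓ ⊆ A ∧ 3 ≤ ℓ.card ∧ FinClique R ℓ ∧
    ∀ ℓ' : Finset M, ℓ' ⊆ A → FinClique R ℓ' → ℓ ⊆ ℓ' → ℓ' = ℓ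

/-- The (finite) set of nontrivial lines of the induced structure on `A`. -/
noncomputable def linesOf {M : Type*} (R : M → M → M → Prop) (A : Finset M) :
    Finset (Finset M) :=
  A.powerset.filter fun ℓ => IsLineOf R A ℓ

/-- The predimension `δ(A) = |A| - Σ_{ℓ ∈ L(A)} (|ℓ| - 2)`. -/
noncomputable def delta {M : Type*} (R : M → M → M → Prop) (A : Finset M) : ℤ :=
  (A.card : ℤ) - ∑ ℓ ∈ linesOf R A, ((ℓ.card : ℤ) - 2)

/-- Membership in the class `K₀`: all subsets have nonnegative predimension. -/
def InK0 {M : Type*} (R : M → M → M → Prop) (A : Finset M) : Prop :=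
  ∀ A' ⊆ A, 0 ≤ delta R A'

/-- `A ≤ B`: `A` is a strong substructure of `B`. -/
def Strong {M : Type*} (R : M → M → M → Prop) (A B : Finset M) : Prop :=
  A ⊆ B ∧ ∀ X : Finset M, A ⊆ X → X ⊆ B → delta R A ≤ delta R X

/-- `C` is a primitive extension of `B`. -/
def PrimitiveExt {M : Type*} (R : M → M → M → Prop) (B C : Finset M) : Prop :=
  Strong R B C ∧ ¬ ∃ A₀ : Finset M, B ⊂ A₀ ∧ A₀ ⊂ C ∧ Strong R B A₀ ∧ Strong R A₀ C

/-- `A` is `0`-primitive over `B` (with `A` the set of new points, disjoint from `B`). -/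
def ZeroPrimOver {M : Type*} (R : M → M → M → Prop) (B A : Finset M) : Prop :=
  Disjoint B A ∧ A.Nonempty ∧ PrimitiveExt R B (B ∪ A) ∧ delta R (B ∪ A) = delta R B

/-- `(B, A)` is a good pair. -/
def GoodPair {M : Type*} (R : M → M → M → Prop) (B A : Finset M) : Prop :=
  ZeroPrimOver R B A ∧ ∀ B' : Finset M, B' ⊂ B → ¬ ZeroPrimOver R B' A

/-- The points of `A` on the line spanned by `a` and `b`. -/
noncomputable def spanLine {M : Type*} (R : M → M → M → Prop) (A : Finset M) (a b : M) :
    Finset M :=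
  A.filter fun p => p = a ∨ p = b ∨ R a b p

lemma mem_spanLine {M : Type*} {R : M → M → M → Prop} {A : Finset M} {a b p : M} :
    p ∈ spanLine R A a b ↔ p ∈ A ∧ (p = a ∨ p = b ∨ R a b p) :=
  Finset.mem_filter

lemma finClique_spanLine {M : Type*} {R : M → M → M → Prop} (hLS : IsLinearSpace R)
    (A : Finset M) (a b : M) : FinClique R (spanLine R A a b) := by
  have key : ∀ {x y z : M}, R a b x → R a b y → R a b z → x ≠ y → y ≠ z → x ≠ z →
      R x y z := by
    intro x y z hx hy hz hxy hyz hxz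
    have h1 : R x a y := hLS.swap12 (hLS.swap23 (hLS.line hx hy hxy))
    have h2 : R x a z := hLS.swap12 (hLS.swap23 (hLS.line hx hz hxz))
    exact hLS.swap23 (hLS.line h1 h2 hyz)
  have keya : ∀ {x y : M}, R a b x → R a b y → x ≠ y → R a x y := fun hx hy hxy =>
    hLS.swap23 (hLS.line hx hy hxy)
  have keyb : ∀ {x y : M}, R a b x → R a b y → x ≠ y → R b x y := fun hx hy hxy =>
    hLS.swap23 (hLS.line (hLS.swap12 hx) (hLS.swap12 hy) hxy)
  have s12 := @hLS.swap12
  have s23 := @hLS.swap23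
  intro x hx y hy z hz hxy hyz hxz
  obtain ⟨-, hx⟩ := mem_spanLine.1 hx
  obtain ⟨-, hy⟩ := mem_spanLine.1 hy
  obtain ⟨-, hz⟩ := mem_spanLine.1 hz
  rcases hx with rfl | rfl | hx <;> rcases hy with rfl | rfl | hy <;>
    rcases hz with rfl | rfl | hz <;> first
      | exact absurd rfl ‹_ ≠ _›
      | exact key hx hy hz hxy hyz hxz
      | grind

lemma FinClique.subset_spanLine {M : Type*} {R : M → M → M → Prop} {A Y : Finset M} {a b : M}
    (hY : FinClique R Y) (hYA : Y ⊆ A) (ha : a ∈ Y) (hb : b ∈ Y) (hab : a ≠ b) :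
    Y ⊆ spanLine R A a b := by
  intro p hp
  rw [mem_spanLine]
  refine ⟨hYA hp, ?_⟩
  by_cases h1 : p = a
  · exact Or.inl h1
  by_cases h2 : p = b
  · exact Or.inr (Or.inl h2)
  exact Or.inr (Or.inr (hY a ha b hb p hp hab (Ne.symm h2) (Ne.symm h1)))

lemma mem_linesOf {M : Type*} {R : M → M → M → Prop} {A ℓ : Finset M} :
    ℓ ∈ linesOf R A ↔ IsLineOf R A ℓ := by
  rw [linesOf, Finset.mem_filter, Finset.mem_powerset]
  exact ⟨fun h => h.2, fun h => ⟨h.1, h⟩⟩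

lemma IsLineOf.eq_spanLine {M : Type*} {R : M → M → M → Prop} (hLS : IsLinearSpace R)
    {A ℓ : Finset M} (hℓ : IsLineOf R A ℓ) {a b : M} (ha : a ∈ ℓ) (hb : b ∈ ℓ) (hab : a ≠ b) :
    ℓ = spanLine R A a b :=
  (hℓ.2.2.2 _ (Finset.filter_subset _ _) (finClique_spanLine hLS A a b)
    (hℓ.2.2.1.subset_spanLine hℓ.1 ha hb hab)).symm

lemma isLineOf_spanLine {M : Type*} {R : M → M → M → Prop} (hLS : IsLinearSpace R)
    {A : Finset M} {a b : M} (ha : a ∈ A) (hb : b ∈ A) (hab : a ≠ b)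
    (hcard : 3 ≤ (spanLine R A a b).card) : IsLineOf R A (spanLine R A a b) := by
  refine ⟨Finset.filter_subset _ _, hcard, finClique_spanLine hLS A a b, ?_⟩
  intro Y hYA hY hsub
  exact (hY.subset_spanLine hYA (hsub (mem_spanLine.2 ⟨ha, Or.inl rfl⟩))
    (hsub (mem_spanLine.2 ⟨hb, Or.inr (Or.inl rfl)⟩)) hab).antisymm hsub

lemma spanLine_insert_erase {M : Type*} {R : M → M → M → Prop} {X : Finset M} {c : M}
    (hc : c ∉ X) (a b : M) : (spanLine R (insert c X) a b).erase c = spanLine R X a b := by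
  ext p
  simp only [Finset.mem_erase, mem_spanLine, Finset.mem_insert]
  constructor
  · rintro ⟨h1, h2 | h2, h3⟩
    · exact absurd h2 h1
    · exact ⟨h2, h3⟩
  · rintro ⟨h1, h2⟩
    exact ⟨fun h => hc (h ▸ h1), Or.inr h1, h2⟩

lemma linesOf_eq_image_erase {M : Type*} {R : M → M → M → Prop} (hLS : IsLinearSpace R)
    {X : Finset M} {c : M} (hc : c ∉ X) :
    linesOf R X = ((linesOf R (insert c X)).filter fun m => 3 ≤ (m.erase c).card).image
      fun m => m.erase c := by
  ext ℓ
  simp only [Finset.mem_image, Finset.mem_filter, mem_linesOf]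
  constructor
  · intro hℓ
    obtain ⟨a, ha, b, hb, hab⟩ := Finset.one_lt_card.1 (show 1 < ℓ.card by have := hℓ.2.1; omega)
    have heq := hℓ.eq_spanLine hLS ha hb hab
    have her := spanLine_insert_erase (R := R) hc a b
    rw [← heq] at her
    refine ⟨spanLine R (insert c X) a b, ⟨isLineOf_spanLine hLS
      (Finset.mem_insert_of_mem (hℓ.1 ha)) (Finset.mem_insert_of_mem (hℓ.1 hb)) hab ?_, ?_⟩, her⟩
    · exact hℓ.2.1.trans (her ▸ Finset.card_le_card (Finset.erase_subset _ _))
    · rw [her]; exact hℓ.2.1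
  · rintro ⟨m, ⟨hm, hcard⟩, rfl⟩
    obtain ⟨a, ha, b, hb, hab⟩ := Finset.one_lt_card.1 (show 1 < (m.erase c).card by omega)
    have heq := hm.eq_spanLine hLS (Finset.mem_of_mem_erase ha) (Finset.mem_of_mem_erase hb) hab
    have hsub : m.erase c ⊆ X := by
      intro p hp
      exact (Finset.mem_insert.1 (hm.1 (Finset.mem_of_mem_erase hp))).resolve_left
        (Finset.ne_of_mem_erase hp)
    have her : m.erase c = spanLine R X a b := by
      conv_lhs => rw [heq]
      exact spanLine_insert_erase hc a b
    rw [her] at hcard ⊢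
    rw [her] at hsub ha hb
    exact isLineOf_spanLine hLS (hsub ha) (hsub hb) hab hcard

/-- Adding one point changes `δ` by one minus the number of lines through that point. -/
lemma delta_insert {M : Type*} {R : M → M → M → Prop} (hLS : IsLinearSpace R)
    {X : Finset M} {c : M} (hc : c ∉ X) :
    delta R (insert c X) =
      delta R X + 1 - (((linesOf R (insert c X)).filter fun m => c ∈ m).card : ℤ) := by
  have hinj : Set.InjOn (fun m : Finset M => m.erase c)
      (((linesOf R (insert c X)).filter fun m => 3 ≤ (m.erase c).card : Finset (Finset M)) :
        Set (Finset M)) := by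
    intro m hm m' hm' h
    simp only [Finset.coe_filter, Set.mem_ofPred_eq, mem_linesOf] at hm hm'
    simp only at h
    obtain ⟨a, ha, b, hb, hab⟩ := Finset.one_lt_card.1 (show 1 < (m.erase c).card by omega)
    rw [hm.1.eq_spanLine hLS (Finset.mem_of_mem_erase ha) (Finset.mem_of_mem_erase hb) hab]
    rw [h] at ha hb
    rw [hm'.1.eq_spanLine hLS (Finset.mem_of_mem_erase ha) (Finset.mem_of_mem_erase hb) hab]
  have hsum : ∑ ℓ ∈ linesOf R X, ((ℓ.card : ℤ) - 2) =
      ∑ m ∈ linesOf R (insert c X), (((m.erase c).card : ℤ) - 2) := by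
    rw [linesOf_eq_image_erase hLS hc, Finset.sum_image hinj]
    apply Finset.sum_filter_of_ne
    intro m hm hne
    have h3 := (mem_linesOf.1 hm).2.1
    have := Finset.pred_card_le_card_erase (s := m) (a := c)
    omega
  have hpoint : ∑ m ∈ linesOf R (insert c X), ((m.card : ℤ) - 2) =
      ∑ m ∈ linesOf R (insert c X), ((((m.erase c).card : ℤ) - 2) + if c ∈ m then 1 else 0) := by
    apply Finset.sum_congr rfl
    intro m _
    split_ifs with h
    · have := Finset.card_erase_add_one h
      omega
    · rw [Finset.erase_eq_of_notMem h]; ring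
  rw [delta, delta, hpoint, Finset.sum_add_distrib, ← hsum, Finset.card_insert_of_notMem hc,
    Finset.card_filter]
  push_cast
  ring

lemma delta_of_card_le_two {M : Type*} {R : M → M → M → Prop} {A : Finset M}
    (h : A.card ≤ 2) : delta R A = A.card := by
  have : linesOf R A = ∅ := by
    refine Finset.eq_empty_of_forall_notMem fun ℓ hℓ => ?_
    obtain ⟨h1, h2, -⟩ := mem_linesOf.1 hℓ
    have := Finset.card_le_card h1
    omega
  simp [delta, this]

lemma delta_of_finClique {M : Type*} {R : M → M → M → Prop} {A : Finset M}
    (hA : FinClique R A) (h : 3 ≤ A.card) : delta R A = 2 := by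
  have : linesOf R A = {A} := by
    ext ℓ
    rw [mem_linesOf, Finset.mem_singleton]
    constructor
    · intro hℓ
      exact (hℓ.2.2.2 A subset_rfl hA hℓ.1).symm
    · rintro rfl
      exact ⟨subset_rfl, h, hA, fun ℓ' h1 _ h2 => h1.antisymm h2⟩
  simp [delta, this]

lemma Finset.eq_or_eq_insert_of_subset_insert {M : Type*} {B X : Finset M} {c : M}
    (h1 : B ⊆ X) (h2 : X ⊆ insert c B) : X = B ∨ X = insert c B := by
  by_cases hc : c ∈ X
  · exact Or.inr (h2.antisymm (Finset.insert_subset hc h1))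
  · exact Or.inl (((Finset.subset_insert_iff_of_notMem hc).1 h2).antisymm h1)

lemma strong_insert {M : Type*} {R : M → M → M → Prop} {B : Finset M} {c : M}
    (h : delta R B ≤ delta R (insert c B)) : Strong R B (insert c B) := by
  refine ⟨Finset.subset_insert _ _, fun X h1 h2 => ?_⟩
  rcases Finset.eq_or_eq_insert_of_subset_insert h1 h2 with rfl | rfl
  · exact le_rfl
  · exact h

lemma goodPair_singleton {M : Type*} {R : M → M → M → Prop} {B : Finset M} {c : M}
    (hB : B.card = 2) (hc : c ∉ B) (hcl : FinClique R (insert c B)) : GoodPair R B {c} := by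
  have hd1 : delta R B = 2 := by rw [delta_of_card_le_two hB.le, hB]; rfl
  have hd2 : delta R (insert c B) = 2 :=
    delta_of_finClique hcl (by rw [Finset.card_insert_of_notMem hc, hB])
  refine ⟨⟨Finset.disjoint_singleton_right.2 hc, Finset.singleton_nonempty c, ?_, ?_⟩, ?_⟩
  · rw [Finset.union_comm, ← Finset.insert_eq]
    refine ⟨strong_insert (by rw [hd1, hd2]), ?_⟩
    rintro ⟨A, h1, h2, -⟩
    rcases Finset.eq_or_eq_insert_of_subset_insert h1.1 h2.1 with rfl | rfl
    · exact h1.ne rfl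
    · exact h2.ne rfl
  · rw [Finset.union_comm, ← Finset.insert_eq, hd1, hd2]
  · rintro B'' hB'' ⟨hdis, -, -, hd⟩
    have hlt := Finset.card_lt_card hB''
    have hc' : c ∉ B'' := Finset.disjoint_singleton_right.1 hdis
    have hcard := Finset.card_insert_of_notMem hc'
    rw [Finset.union_comm, ← Finset.insert_eq, delta_of_card_le_two (by omega),
      delta_of_card_le_two (by omega), hcard] at hd
    push_cast at hd
    omega

lemma FinClique.mono {M : Type*} {R : M → M → M → Prop} {X Y : Finset M}
    (hY : FinClique R Y) (h : X ⊆ Y) : FinClique R X :=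
  fun a ha b hb c hc => hY a (h ha) b (h hb) c (h hc)

/-- A point on a line based in `B` does not increase `δ` when added to `B`. -/
lemma delta_insert_le {M : Type*} {R : M → M → M → Prop} (hLS : IsLinearSpace R)
    {B ℓ : Finset M} {c : M} (hc : c ∉ B) (hℓ : FinClique R ℓ) (hcℓ : c ∈ ℓ)
    (hbase : 2 ≤ (ℓ ∩ B).card) : delta R (insert c B) ≤ delta R B := by
  obtain ⟨a, ha, b, hb, hab⟩ := Finset.one_lt_card.1 hbase
  have hsub : insert c (ℓ ∩ B) ⊆ spanLine R (insert c B) a b :=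
    (hℓ.mono (Finset.insert_subset hcℓ Finset.inter_subset_left)).subset_spanLine
      (Finset.insert_subset_insert _ Finset.inter_subset_right)
      (Finset.mem_insert_of_mem ha) (Finset.mem_insert_of_mem hb) hab
  have hcard : 3 ≤ (spanLine R (insert c B) a b).card := by
    have := Finset.card_le_card hsub
    rw [Finset.card_insert_of_notMem fun h => hc (Finset.mem_inter.1 h).2] at this
    omega
  have hline := isLineOf_spanLine hLS
    (Finset.mem_insert_of_mem (Finset.mem_inter.1 ha).2)
    (Finset.mem_insert_of_mem (Finset.mem_inter.1 hb).2) hab hcard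
  have hpos : 0 < ((linesOf R (insert c B)).filter fun m => c ∈ m).card :=
    Finset.card_pos.2 ⟨_, Finset.mem_filter.2
      ⟨mem_linesOf.2 hline, hsub (Finset.mem_insert_self _ _)⟩⟩
  rw [delta_insert hLS hc]
  omega

/-- For a `0`-primitive extension `B ⊊ C` in `K₀`: some point of `C \ B` lies on a line
of `C` based in `B` iff `|C \ B| = 1`; and in that case, writing `C \ B = {c}` and `ℓ`
for a line of `C` through `c` based in `B`: every 2-element subset `B'` of `ℓ ∩ B` gives
a good pair `(B', {c})`, and a point `b ∈ B` lies on a common nontrivial line of `C`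
with `c` iff `b ∈ ℓ`. -/
theorem zero_primitive_singleton_case {M : Type*} (R : M → M → M → Prop)
    (hLS : IsLinearSpace R) (B C : Finset M) (hK0 : InK0 R C) (hBC : B ⊂ C)
    (hprim : PrimitiveExt R B C) (h0 : delta R C = delta R B) :
    ((∃ c ∈ C \ B, ∃ ℓ ∈ linesOf R C, c ∈ ℓ ∧ 2 ≤ (ℓ ∩ B).card) ↔ (C \ B).card = 1) ∧
    (∀ c : M, C \ B = {c} → ∀ ℓ ∈ linesOf R C, c ∈ ℓ → 2 ≤ (ℓ ∩ B).card →
      (∀ B' ⊆ ℓ ∩ B, B'.card = 2 → GoodPair R B' {c}) ∧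
      (∀ b ∈ B, (∃ m ∈ linesOf R C, b ∈ m ∧ c ∈ m) ↔ b ∈ ℓ)) := by
  obtain ⟨hBsub, -⟩ := Finset.ssubset_iff_subset_ne.1 hBC
  have hone : ∀ c, C \ B = {c} → c ∉ B ∧ C = insert c B ∧
      ((linesOf R C).filter fun m => c ∈ m).card = 1 := by
    intro c hcB
    have hmem : c ∈ C \ B := hcB ▸ Finset.mem_singleton_self c
    have hc := (Finset.mem_sdiff.1 hmem).2
    have hC : C = insert c B := by
      rw [← Finset.sdiff_union_of_subset hBsub, hcB, Finset.insert_eq]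
    refine ⟨hc, hC, ?_⟩
    have hd := delta_insert hLS hc
    rw [← hC] at hd
    omega
  refine ⟨⟨?_, ?_⟩, ?_⟩
  · rintro ⟨c, hcCB, ℓ, hℓ, hcℓ, hbase⟩
    obtain ⟨hcC, hc⟩ := Finset.mem_sdiff.1 hcCB
    have hsub : insert c B ⊆ C := Finset.insert_subset hcC hBsub
    have hle := delta_insert_le hLS hc (mem_linesOf.1 hℓ).2.2.1 hcℓ hbase
    have hge := hprim.1.2 _ (Finset.subset_insert c B) hsub
    have hC : insert c B = C := by
      by_contra hne
      exact hprim.2 ⟨insert c B, Finset.ssubset_insert hc, hsub.ssubset_of_ne hne,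
        strong_insert hge, hsub, fun X h1 h2 =>
          hle.trans (hprim.1.2 X ((Finset.subset_insert c B).trans h1) h2)⟩
    rw [← hC, Finset.insert_sdiff_cancel hc, Finset.card_singleton]
  · intro h
    obtain ⟨c, hcB⟩ := Finset.card_eq_one.1 h
    obtain ⟨hc, hC, hcount⟩ := hone c hcB
    obtain ⟨ℓ, hℓ⟩ := Finset.card_pos.1 (hcount ▸ Nat.one_pos)
    obtain ⟨hℓ, hcℓ⟩ := Finset.mem_filter.1 hℓ
    refine ⟨c, hcB ▸ Finset.mem_singleton_self c, ℓ, hℓ, hcℓ, ?_⟩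
    obtain ⟨hℓC, h3, -⟩ := mem_linesOf.1 hℓ
    have hsub : ℓ.erase c ⊆ ℓ ∩ B := fun p hp => Finset.mem_inter.2
      ⟨Finset.mem_of_mem_erase hp, (Finset.mem_insert.1
        (hC ▸ hℓC (Finset.mem_of_mem_erase hp))).resolve_left (Finset.ne_of_mem_erase hp)⟩
    have := Finset.card_le_card hsub
    have := Finset.card_erase_add_one hcℓ
    omega
  · intro c hcB ℓ hℓ hcℓ _
    obtain ⟨hc, -, hcount⟩ := hone c hcB
    refine ⟨fun B' hB' hcard => ?_, fun b _ => ⟨?_, fun hbℓ => ⟨ℓ, hℓ, hbℓ, hcℓ⟩⟩⟩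
    · exact goodPair_singleton hcard (fun h => hc (Finset.mem_inter.1 (hB' h)).2)
        ((mem_linesOf.1 hℓ).2.2.1.mono
          (Finset.insert_subset hcℓ (hB'.trans Finset.inter_subset_left)))
    · rintro ⟨m, hm, hbm, hcm⟩
      rwa [Finset.card_le_one.1 hcount.le ℓ (Finset.mem_filter.2 ⟨hℓ, hcℓ⟩) m
        (Finset.mem_filter.2 ⟨hm, hcm⟩)]
end

section
/- The function δ is submodular: for any subsets A and C of a finite linear space D with B = A ∩ C, δ(A ∪ C) ≤ δ(A) + δ(C) − δ(B); equivalently, δ(A/B) ≥ δ((A ∪ C)/C), where δ(X/Y) := δ(X ∪ Y) − δ(Y) and each δ is computed in the induced structure. -/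
open scoped Classical

/-- The points of `U` lying on the line through `x` and `y`. -/
noncomputable def lineThrough {M : Type*} (R : M → M → M → Prop) (U : Finset M) (x y : M) :
    Finset M :=
  U.filter fun z => z = x ∨ z = y ∨ R x y z

section LinearSpace

variable {M : Type*} {R : M → M → M → Prop} {U X m : Finset M} {x y : M}

lemma lineThrough_inter (hX : X ⊆ U) : lineThrough R U x y ∩ X = lineThrough R X x y := by
  ext z
  have := @hX z
  simp only [lineThrough, Finset.mem_inter, Finset.mem_filter]
  tauto

lemma FinClique.subset_lineThrough (h : FinClique R m) (hm : m ⊆ U) (hx : x ∈ m) (hy : y ∈ m)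
    (hxy : x ≠ y) : m ⊆ lineThrough R U x y := by
  intro z hz
  refine Finset.mem_filter.2 ⟨hm hz, ?_⟩
  by_cases hzx : z = x
  · exact Or.inl hzx
  by_cases hzy : z = y
  · exact Or.inr (Or.inl hzy)
  exact Or.inr (Or.inr (h x hx y hy z hz hxy (Ne.symm hzy) (Ne.symm hzx)))

lemma IsLinearSpace.collinear (hLS : IsLinearSpace R) {a b c : M} (ha : R x y a) (hb : R x y b)
    (hc : R x y c) (hab : a ≠ b) (hbc : b ≠ c) (hac : a ≠ c) : R a b c := by
  have h1 : R x a b := hLS.line hb ha hab.symm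
  have h2 : R x a c := hLS.line hc ha hac.symm
  exact hLS.line (hLS.swap12 h2) (hLS.swap12 h1) hbc.symm

lemma IsLinearSpace.finClique_lineThrough (hLS : IsLinearSpace R) :
    FinClique R (lineThrough R U x y) := by
  intro a ha b hb c hc hab hbc hac
  have s12 := @hLS.swap12
  have s23 := @hLS.swap23
  have hl := @hLS.line
  replace ha := (Finset.mem_filter.1 ha).2
  replace hb := (Finset.mem_filter.1 hb).2
  replace hc := (Finset.mem_filter.1 hc).2
  rcases ha with rfl | rfl | ha <;> rcases hb with rfl | rfl | hb <;>
    rcases hc with rfl | rfl | hc <;>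
    first
    | exact hLS.collinear ha hb hc hab hbc hac
    | grind

lemma IsLineOf.eq_lineThrough (hLS : IsLinearSpace R) (h : IsLineOf R U m) (hx : x ∈ m)
    (hy : y ∈ m) (hxy : x ≠ y) : m = lineThrough R U x y :=
  (h.2.2.2 _ (Finset.filter_subset _ _) hLS.finClique_lineThrough
    (h.2.2.1.subset_lineThrough h.1 hx hy hxy)).symm

lemma IsLinearSpace.isLineOf_lineThrough (hLS : IsLinearSpace R) (hx : x ∈ U) (hy : y ∈ U)
    (hxy : x ≠ y) (hcard : 3 ≤ (lineThrough R U x y).card) :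
    IsLineOf R U (lineThrough R U x y) := by
  refine ⟨Finset.filter_subset _ _, hcard, hLS.finClique_lineThrough, fun m hm hcl hsub => ?_⟩
  refine (hcl.subset_lineThrough hm (hsub ?_) (hsub ?_) hxy).antisymm hsub <;>
    simp [lineThrough, hx, hy]

lemma mem_linesOf_s14 : m ∈ linesOf R U ↔ IsLineOf R U m := by
  simp only [linesOf, Finset.mem_filter, Finset.mem_powerset, and_iff_right_iff_imp]
  exact fun h => h.1

/-- The lines of `X ⊆ U` are the traces on `X` of the lines of `U` meeting `X` in at least
three points, so the sum defining `delta R X` can be taken over the lines of `U`. -/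
lemma IsLinearSpace.sum_linesOf (hLS : IsLinearSpace R) (hX : X ⊆ U) :
    ∑ ℓ ∈ linesOf R X, ((ℓ.card : ℤ) - 2) =
      ∑ ℓ ∈ linesOf R U, (((ℓ ∩ X).card - 2 : ℕ) : ℤ) := by
  rw [← Finset.sum_filter_of_ne (s := linesOf R U) (p := fun ℓ => 3 ≤ (ℓ ∩ X).card)
    (fun ℓ _ hne => by by_contra hlt; exact hne (by omega))]
  symm
  refine Finset.sum_bij (fun ℓ _ => ℓ ∩ X) ?_ ?_ ?_ ?_
  · intro ℓ hℓ
    obtain ⟨hℓ, hcard⟩ := Finset.mem_filter.1 hℓ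
    rw [mem_linesOf_s14] at hℓ ⊢
    obtain ⟨x, hx, y, hy, hxy⟩ := Finset.one_lt_card.1 (show 1 < (ℓ ∩ X).card by omega)
    rw [Finset.mem_inter] at hx hy
    have he := hℓ.eq_lineThrough hLS hx.1 hy.1 hxy
    rw [he, lineThrough_inter hX] at hcard ⊢
    exact hLS.isLineOf_lineThrough hx.2 hy.2 hxy hcard
  · intro ℓ₁ h₁ ℓ₂ h₂ heq
    obtain ⟨h₁, hcard⟩ := Finset.mem_filter.1 h₁
    have h₂ := (Finset.mem_filter.1 h₂).1
    rw [mem_linesOf_s14] at h₁ h₂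
    obtain ⟨x, hx, y, hy, hxy⟩ := Finset.one_lt_card.1 (show 1 < (ℓ₁ ∩ X).card by omega)
    have hx₂ : x ∈ ℓ₂ ∩ X := heq ▸ hx
    have hy₂ : y ∈ ℓ₂ ∩ X := heq ▸ hy
    rw [Finset.mem_inter] at hx hy hx₂ hy₂
    rw [h₁.eq_lineThrough hLS hx.1 hy.1 hxy, h₂.eq_lineThrough hLS hx₂.1 hy₂.1 hxy]
  · intro m hm
    rw [mem_linesOf_s14] at hm
    have hcard := hm.2.1
    obtain ⟨x, hx, y, hy, hxy⟩ := Finset.one_lt_card.1 (show 1 < m.card by omega)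
    have he : lineThrough R U x y ∩ X = m :=
      (lineThrough_inter hX).trans (hm.eq_lineThrough hLS hx hy hxy).symm
    have hcard' : 3 ≤ (lineThrough R U x y).card :=
      hcard.trans (Finset.card_le_card (he ▸ Finset.inter_subset_left))
    refine ⟨lineThrough R U x y, Finset.mem_filter.2 ⟨mem_linesOf_s14.2 ?_, by rwa [he]⟩, he⟩
    exact hLS.isLineOf_lineThrough (hX (hm.1 hx)) (hX (hm.1 hy)) hxy hcard'
  · intro ℓ hℓ
    have := (Finset.mem_filter.1 hℓ).2
    omega

lemma card_inter_sub_two_supermodular (s A C : Finset M) :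
    ((s ∩ A).card - 2) + ((s ∩ C).card - 2) ≤
      ((s ∩ (A ∪ C)).card - 2) + ((s ∩ (A ∩ C)).card - 2) := by
  have h := Finset.card_union_add_card_inter (s ∩ A) (s ∩ C)
  rw [← Finset.inter_union_distrib_left, ← Finset.inter_inter_distrib_left] at h
  have h₁ : (s ∩ (A ∩ C)).card ≤ (s ∩ A).card := by gcongr; exact Finset.inter_subset_left
  have h₂ : (s ∩ (A ∩ C)).card ≤ (s ∩ C).card := by gcongr; exact Finset.inter_subset_right
  omega

lemma IsLinearSpace.delta_union_add_delta_inter_le (hLS : IsLinearSpace R) (A C : Finset M) :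
    delta R (A ∪ C) + delta R (A ∩ C) ≤ delta R A + delta R C := by
  have hcard := Finset.card_union_add_card_inter A C
  have hsum := Finset.sum_le_sum (s := linesOf R (A ∪ C)) fun ℓ _ =>
    Nat.cast_le (α := ℤ).2 (card_inter_sub_two_supermodular ℓ A C)
  simp only [Nat.cast_add, Finset.sum_add_distrib] at hsum
  rw [← hLS.sum_linesOf Finset.subset_union_left, ← hLS.sum_linesOf Finset.subset_union_right,
    ← hLS.sum_linesOf (Finset.Subset.refl _),
    ← hLS.sum_linesOf (Finset.inter_subset_left.trans Finset.subset_union_left)] at hsum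
  unfold delta
  linarith [(by exact_mod_cast hcard :
    ((A ∪ C).card : ℤ) + (A ∩ C).card = A.card + C.card)]

end LinearSpace

/-- Submodularity of `δ`: for subsets `A`, `C` of a finite linear space `D`, with
`B = A ∩ C`, `δ(A ∪ C) ≤ δ(A) + δ(C) - δ(B)`; equivalently
`δ(A/B) ≥ δ((A ∪ C)/C)` where `δ(X/Y) := δ(X ∪ Y) - δ(Y)`. -/
theorem delta_submodular {M : Type*} (R : M → M → M → Prop) (hLS : IsLinearSpace R)
    (D A C : Finset M) (hA : A ⊆ D) (hC : C ⊆ D) :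
    delta R (A ∪ C) ≤ delta R A + delta R C - delta R (A ∩ C) ∧
    delta R (A ∪ C) - delta R C ≤ delta R (A ∪ (A ∩ C)) - delta R (A ∩ C) := by
  have h := hLS.delta_union_add_delta_inter_le A C
  rw [Finset.union_eq_left.2 (Finset.inter_subset_left : A ∩ C ⊆ A)]
  constructor <;> linarith
end
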